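/- Let a : ℝ² → ℂ be smooth on (−a₀,a₀)×(−b₀,b₀), let L = ∂/∂y + a(x,y)∂/∂x be locally integrable at the origin, and let u be a bounded measurable function on (−a₀,a₀)×(0,b₀) satisfying Lu = 0 in the sense of distributions. Suppose the weak boundary value of u vanishes: there is a Lebesgue-null set N ⊂ (0,b₀) such that for every φ ∈ C_c^∞(−a₀,a₀), ∫ u(x,y)φ(x) dx → 0 as y → 0⁺ with y ∉ N. Then there exists δ > 0 such that u = 0 almost everywhere on (−δ,δ)×(0,δ). -/

import Mathlib

open MeasureTheory Set Filter Topology Complex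

/-- Partial derivative in the `x` direction. -/
noncomputable def pdx (f : ℝ × ℝ → ℂ) (p : ℝ × ℝ) : ℂ := fderiv ℝ f p (1, 0)

/-- Partial derivative in the `y` direction. -/
noncomputable def pdy (f : ℝ × ℝ → ℂ) (p : ℝ × ℝ) : ℂ := fderiv ℝ f p (0, 1)

/-- `u` satisfies `Lu = 0` in the sense of distributions on `Ω`, where
`L = ∂/∂y + a ∂/∂x`. -/
def IsDistribSol (a u : ℝ × ℝ → ℂ) (Ω : Set (ℝ × ℝ)) : Prop :=
  ∀ ψ : ℝ × ℝ → ℂ, ContDiff ℝ (⊤ : ℕ∞) ψ → HasCompactSupport ψ → tsupport ψ ⊆ Ω →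
    ∫ p in Ω, u p * (pdy ψ p + pdx (fun q => a q * ψ q) p) = 0

/-- `L = ∂/∂y + a ∂/∂x` is locally integrable at the origin: there is a smooth
first integral `Z` near `(0,0)` with `LZ = 0` and `dZ(0,0) ≠ 0`. -/
def LocallyIntegrableAtOrigin (a : ℝ × ℝ → ℂ) : Prop :=
  ∃ U : Set (ℝ × ℝ), IsOpen U ∧ (0, 0) ∈ U ∧ ∃ Z : ℝ × ℝ → ℂ,
    ContDiffOn ℝ (⊤ : ℕ∞) Z U ∧ (∀ p ∈ U, pdy Z p + a p * pdx Z p = 0) ∧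
    fderiv ℝ Z (0, 0) ≠ 0

/-- Integration by parts of a smooth compactly supported function against a primitive of an
integrable function. -/
lemma integral_deriv_smul_primitive {R : ℝ → ℂ} (hR : Integrable R) {b : ℝ} {θ : ℝ → ℝ}
    (hθ : ContDiff ℝ (⊤ : ℕ∞) θ) (hc : HasCompactSupport θ) (hs : tsupport θ ⊆ Ioo 0 b) :
    ∫ y, deriv θ y • ∫ s in (0 : ℝ)..y, R s = - ∫ y, θ y • R y := by
  have hθ1 : ContDiff ℝ 1 θ := hθ.of_le (by exact_mod_cast le_top)
  have hd0 : ∀ y ≤ 0, deriv θ y = 0 := fun y hy => by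
    by_contra h
    exact absurd (hs (support_deriv_subset h)).1 (not_lt.2 hy)
  have h0 : ∀ y ≤ 0, θ y = 0 := fun y hy => by
    by_contra h
    exact absurd (hs (subset_tsupport _ h)).1 (not_lt.2 hy)
  let S : Set (ℝ × ℝ) := {p | 0 < p.2 ∧ p.2 < p.1}
  have hS : MeasurableSet S :=
    ((isOpen_lt continuous_const continuous_snd).inter
      (isOpen_lt continuous_snd continuous_fst)).measurableSet
  let F : ℝ → ℝ → ℂ := fun y s => S.indicator (fun p => deriv θ p.1 • R p.2) (y, s)
  have hdi : Integrable (deriv θ) :=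
    (hθ1.continuous_deriv le_rfl).integrable_of_hasCompactSupport hc.deriv
  have hF : Integrable (Function.uncurry F) (volume.prod volume) :=
    (hdi.smul_prod hR).indicator hS
  have h1 : ∀ y, deriv θ y • ∫ s in (0 : ℝ)..y, R s = ∫ s, F y s := by
    intro y
    rcases le_or_gt y 0 with hy | hy
    · have : ∀ s, F y s = 0 := fun s => by
        simp only [F]
        by_cases h : (y, s) ∈ S
        · exact absurd (h.1.trans h.2) (not_lt.2 hy)
        · rw [indicator_of_notMem h]
      simp [this, hd0 y hy]
    · rw [intervalIntegral.integral_of_le hy.le, integral_Ioc_eq_integral_Ioo, ← integral_smul,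
        ← integral_indicator measurableSet_Ioo]
      congr 1
  have h2 : ∀ s, ∫ y, F y s = - (θ s • R s) := by
    intro s
    rcases le_or_gt s 0 with hs' | hs'
    · have : ∀ y, F y s = 0 := fun y => by
        simp only [F]
        by_cases h : (y, s) ∈ S
        · exact absurd h.1 (not_lt.2 hs')
        · rw [indicator_of_notMem h]
      simp [this, h0 s hs']
    · have : (fun y => F y s) = (Ioi s).indicator (fun y => deriv θ y • R s) := by
        ext y
        simp [F, S, indicator, hs']
      rw [this, integral_indicator measurableSet_Ioi, integral_smul_const,
        hc.integral_Ioi_deriv_eq hθ1, neg_smul]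
  calc _ = ∫ y, ∫ s, F y s := by simp_rw [h1]
    _ = ∫ s, ∫ y, F y s := integral_integral_swap hF
    _ = _ := by simp_rw [h2]; rw [integral_neg]

/-- The primitive of a test function of zero mean is a test function. -/
lemma exists_primitive_of_integral_eq_zero {b : ℝ} {f : ℝ → ℝ} (hf : ContDiff ℝ (⊤ : ℕ∞) f)
    (hc : HasCompactSupport f) (hs : tsupport f ⊆ Ioo 0 b) (h0 : ∫ y, f y = 0) :
    ∃ θ : ℝ → ℝ, ContDiff ℝ (⊤ : ℕ∞) θ ∧ HasCompactSupport θ ∧ tsupport θ ⊆ Ioo 0 b ∧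
      deriv θ = f := by
  obtain ⟨α, β, hα, hβ, hsub⟩ : ∃ α β : ℝ, 0 < α ∧ β < b ∧ tsupport f ⊆ Icc α β := by
    rcases (tsupport f).eq_empty_or_nonempty with h | h
    · exact ⟨1, b - 1, one_pos, by linarith, by simp [h]⟩
    · obtain ⟨α, hα, hα'⟩ := hc.exists_isMinOn h continuousOn_id
      obtain ⟨β, hβ, hβ'⟩ := hc.exists_isMaxOn h continuousOn_id
      exact ⟨α, β, (hs hα).1, (hs hβ).2, fun x hx => ⟨hα' hx, hβ' hx⟩⟩
  have hz : ∀ y, y ∉ Icc α β → f y = 0 := fun y hy => by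
    by_contra h
    exact hy (hsub (subset_tsupport _ h))
  have hder : ∀ y, HasDerivAt (fun y => ∫ s in (0 : ℝ)..y, f s) (f y) y := fun y =>
    (hf.continuous.integral_hasStrictDerivAt 0 y).hasDerivAt
  have hderiv : deriv (fun y => ∫ s in (0 : ℝ)..y, f s) = f := funext fun y => (hder y).deriv
  have hzero : ∀ y, y ∉ Icc α β → ∫ s in (0 : ℝ)..y, f s = 0 := by
    intro y hy
    rcases lt_or_ge y α with h | h
    · refine (intervalIntegral.integral_congr (g := fun _ => (0 : ℝ)) fun s hs' => hz s ?_).trans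
        (by simp)
      intro h'
      have := hs'.2
      exact absurd (h'.1.trans this) (not_le.2 (max_lt hα h))
    · have hy' : β < y := by
        by_contra h'
        exact hy ⟨h, not_lt.1 h'⟩
      rw [intervalIntegral.integral_of_le (hα.le.trans h)]
      refine (setIntegral_eq_integral_of_forall_compl_eq_zero fun s hs' =>
        hz s fun h' => hs' ?_).trans h0
      exact ⟨hα.trans_le h'.1, h'.2.trans hy'.le⟩
  have hts : tsupport (fun y => ∫ s in (0 : ℝ)..y, f s) ⊆ Icc α β :=
    closure_minimal (fun y hy => by
      by_contra h
      exact hy (hzero y h)) isClosed_Icc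
  refine ⟨_, ?_, isCompact_Icc.of_isClosed_subset (isClosed_tsupport _) hts,
    hts.trans fun y hy => ⟨hα.trans_le hy.1, hy.2.trans_lt hβ⟩, hderiv⟩
  rw [contDiff_infty_iff_deriv, hderiv]
  exact ⟨fun y => (hder y).differentiableAt, hf⟩

/-- A function on `(0, b)` with zero distributional derivative and zero limit at `0` (off a null
set) vanishes almost everywhere. -/
lemma ae_eq_zero_of_weak_deriv_eq_zero {b : ℝ} (hb : 0 < b) {D : ℝ → ℂ} (hD : LocallyIntegrable D)
    {N : Set ℝ} (hN : volume N = 0) (hlim : Tendsto D (𝓝[Ioo 0 b \ N] 0) (𝓝 0))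
    (hw : ∀ θ : ℝ → ℝ, ContDiff ℝ (⊤ : ℕ∞) θ → HasCompactSupport θ → tsupport θ ⊆ Ioo 0 b →
      ∫ y, deriv θ y • D y = 0) :
    ∀ᵐ y, y ∈ Ioo 0 b → D y = 0 := by
  refine isOpen_Ioo.ae_eq_zero_of_integral_contDiff_smul_eq_zero (hD.locallyIntegrableOn _) ?_
  intro g hg hgc hgs
  have hint : ∀ f : ℝ → ℝ, Continuous f → HasCompactSupport f → Integrable (fun y => f y • D y) :=
    fun f hf hfc => hD.integrable_smul_left_of_hasCompactSupport hf hfc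
  rw [← norm_le_zero_iff]
  refine le_of_forall_pos_le_add fun η hη => ?_
  rw [zero_add]
  set m := ∫ y, g y with hm
  obtain ⟨η', hη', hηm⟩ : ∃ η' > 0, |m| * η' ≤ η :=
    ⟨η / (|m| + 1), by positivity, by
      rw [mul_div_assoc', div_le_iff₀ (by positivity)]
      nlinarith [abs_nonneg m]⟩
  obtain ⟨ε, hε, hεD⟩ : ∃ ε > 0, ∀ y ∈ Ioo 0 ε, y < b → y ∉ N → ‖D y‖ ≤ η' := by
    have := (Metric.tendsto_nhdsWithin_nhds.1 hlim) η' hη'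
    obtain ⟨ε, hε, h⟩ := this
    refine ⟨ε, hε, fun y hy hyb hyN => ?_⟩
    have := h (x := y) ⟨⟨hy.1, hyb⟩, hyN⟩ (by
      rw [Real.dist_eq, sub_zero, abs_of_pos hy.1]; exact hy.2)
    simpa using this.le
  set e := min ε b / 2 with he
  have he0 : 0 < e := by have := lt_min hε hb; positivity
  have hee : e + e ≤ ε := by have := min_le_left ε b; linarith
  have heb : e + e ≤ b := by have := min_le_right ε b; linarith
  let B : ContDiffBump e := ⟨e / 4, e / 2, by positivity, by linarith⟩
  let ρ : ℝ → ℝ := B.normed volume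
  have hρs : tsupport ρ = Metric.closedBall e (e / 2) := B.tsupport_normed_eq
  have hρz : ∀ y, y ∉ Ioo 0 (e + e) → ρ y = 0 := fun y hy => by
    by_contra h
    have := hρs ▸ subset_tsupport _ (Function.mem_support.2 h)
    rw [Real.closedBall_eq_Icc] at this
    exact hy ⟨by linarith [this.1], by linarith [this.2]⟩
  have hρc : HasCompactSupport ρ := B.hasCompactSupport_normed
  have hρcont : Continuous ρ := B.continuous_normed
  have hρi : Integrable ρ := hρcont.integrable_of_hasCompactSupport hρc
  have hf : ContDiff ℝ (⊤ : ℕ∞) (fun y => g y - m * ρ y) :=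
    hg.sub (contDiff_const.mul B.contDiff_normed)
  have hfc : HasCompactSupport (fun y => g y - m * ρ y) := hgc.sub (hρc.mul_left)
  have hfs : tsupport (fun y => g y - m * ρ y) ⊆ Ioo 0 b := by
    refine (tsupport_sub g (fun y => m * ρ y)).trans (union_subset hgs ?_)
    refine (tsupport_mul_subset_right (f := fun _ => m) (g := ρ)).trans ?_
    rw [hρs, Real.closedBall_eq_Icc]
    exact fun y hy => ⟨by linarith [hy.1], by linarith [hy.2]⟩
  have hf0 : ∫ y, (g y - m * ρ y) = 0 := by
    rw [integral_sub (hg.continuous.integrable_of_hasCompactSupport hgc) (hρi.const_mul m),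
      integral_const_mul, B.integral_normed, ← hm]
    ring
  obtain ⟨θ, h1, h2, h3, h4⟩ := exists_primitive_of_integral_eq_zero hf hfc hfs hf0
  have h5 := hw θ h1 h2 h3
  simp_rw [h4, sub_smul, mul_smul] at h5
  have hρD : Integrable (fun y => m • ρ y • D y) := (hint ρ hρcont hρc).smul m
  rw [integral_sub (hint g hg.continuous hgc) hρD, integral_smul,
    sub_eq_zero] at h5
  rw [h5, norm_smul, Real.norm_eq_abs]
  refine le_trans (mul_le_mul_of_nonneg_left ?_ (abs_nonneg m)) hηm
  calc ‖∫ y, ρ y • D y‖ ≤ ∫ y, ρ y * η' := by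
        refine norm_integral_le_of_norm_le (hρi.mul_const _) ?_
        filter_upwards [measure_eq_zero_iff_ae_notMem.1 hN] with y hy
        rw [norm_smul, Real.norm_eq_abs, abs_of_nonneg (B.nonneg_normed y)]
        by_cases hy' : y ∈ Ioo 0 (e + e)
        · exact mul_le_mul_of_nonneg_left
            (hεD y ⟨hy'.1, hy'.2.trans_le hee⟩ (hy'.2.trans_le heb) hy) (B.nonneg_normed y)
        · have := hρz y hy'
          simp only [ρ] at this
          simp [ρ, this]
    _ = η' := by rw [integral_mul_const, B.integral_normed, one_mul]

/-- If `G' = R` weakly on `(0, b)` and `G → 0` at `0` off a null set, then `G` is the primitive of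
`R` almost everywhere. -/
lemma ae_eq_primitive_of_weak_deriv {b : ℝ} (hb : 0 < b) {G R : ℝ → ℂ} (hG : Integrable G)
    (hR : Integrable R) {N : Set ℝ} (hN : volume N = 0)
    (hlim : Tendsto G (𝓝[Ioo 0 b \ N] 0) (𝓝 0))
    (hw : ∀ θ : ℝ → ℝ, ContDiff ℝ (⊤ : ℕ∞) θ → HasCompactSupport θ → tsupport θ ⊆ Ioo 0 b →
      ∫ y, deriv θ y • G y = ∫ y, θ y • R y) :
    ∀ᵐ y, y ∈ Ioo 0 b → G y = - ∫ s in (0 : ℝ)..y, R s := by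
  have hP : Continuous fun y => ∫ s in (0 : ℝ)..y, R s :=
    intervalIntegral.continuous_primitive (fun _ _ => hR.intervalIntegrable) 0
  have := ae_eq_zero_of_weak_deriv_eq_zero hb (D := fun y => G y + ∫ s in (0 : ℝ)..y, R s)
    (hG.locallyIntegrable.add hP.locallyIntegrable) hN ?_ ?_
  · filter_upwards [this] with y hy h
    exact eq_neg_of_add_eq_zero_left (hy h)
  · have h0 : Tendsto (fun y => ∫ s in (0 : ℝ)..y, R s) (𝓝[Ioo 0 b \ N] 0) (𝓝 0) := by
      have := (hP.tendsto 0).mono_left (nhdsWithin_le_nhds (s := Ioo 0 b \ N))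
      simpa using this
    simpa using hlim.add h0
  · intro θ h1 h2 h3
    have hd : Continuous (deriv θ) := h1.continuous_deriv (by exact_mod_cast le_top)
    simp_rw [smul_add]
    rw [integral_add, hw θ h1 h2 h3, integral_deriv_smul_primitive hR h1 h2 h3, add_neg_cancel]
    · exact hG.locallyIntegrable.integrable_smul_left_of_hasCompactSupport hd h2.deriv
    · exact hP.locallyIntegrable.integrable_smul_left_of_hasCompactSupport hd h2.deriv

lemma norm_cexp_neg_sq_le {w : ℂ} {t : ℝ} (h : ‖w - t‖ ≤ 3 / 8 * |t|) (n : ℕ) :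
    ‖cexp (-((n : ℂ) * w) ^ 2)‖ ≤ Real.exp (-(1 / 4) * ((n : ℝ) * t) ^ 2) := by
  rw [Complex.norm_exp, Real.exp_le_exp]
  have h1 : (-((n : ℂ) * w) ^ 2).re = -((n : ℝ) ^ 2 * (w.re ^ 2 - w.im ^ 2)) := by
    simp [pow_two]
    ring
  have h2 : (w.re - t) ^ 2 + w.im ^ 2 ≤ 9 / 64 * t ^ 2 := by
    have h3 : ‖w - t‖ ^ 2 ≤ (3 / 8 * |t|) ^ 2 := pow_le_pow_left₀ (norm_nonneg _) h 2
    rw [Complex.sq_norm, Complex.normSq_apply, mul_pow, sq_abs] at h3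
    simp at h3
    nlinarith
  have h4 : t ^ 2 / 4 ≤ w.re ^ 2 - w.im ^ 2 := by
    nlinarith [sq_nonneg (w.re - t + 3 / 8 * t), sq_nonneg (w.re - t - 3 / 8 * t)]
  rw [h1]
  nlinarith [sq_nonneg (n : ℝ)]

section Gaussian

variable {γ γ' : ℝ → ℂ} {r : ℝ} {ψ : ℝ → ℝ} {x' : ℝ}

lemma nat_mul_integral_eq_rescale (f : ℝ → ℂ) (x' : ℝ) {n : ℕ} (hn : n ≠ 0) :
    (n : ℂ) * ∫ x, f x = ∫ s : ℝ, f (x' + (n : ℝ)⁻¹ * s) := by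
  have h := Measure.integral_comp_mul_left (fun x => f (x' + x)) (n : ℝ)⁻¹
  rw [h, integral_add_left_eq_self, inv_inv, abs_of_nonneg (by positivity), Complex.real_smul]
  simp

lemma norm_rescaled_gaussian_le
    (hest : ∀ x ∈ Ioo (-r) r, ∀ x' ∈ Ioo (-r) r, ‖γ x - γ x' - ((x - x' : ℝ) : ℂ)‖ ≤ 1 / 4 * |x - x'|)
    (hs : ∀ x ∉ Ioo (-r) r, ψ x = 0) (hx' : x' ∈ Ioo (-r) r) {M : ℝ}
    (hM : ∀ x, ‖ψ x • γ' x‖ ≤ M) {n : ℕ} (hn : n ≠ 0) (s : ℝ) :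
    ‖cexp (-((n : ℂ) * (γ (x' + (n : ℝ)⁻¹ * s) - γ x')) ^ 2) *
      (ψ (x' + (n : ℝ)⁻¹ * s) • γ' (x' + (n : ℝ)⁻¹ * s))‖ ≤ Real.exp (-(1 / 4) * s ^ 2) * M := by
  have hM0 : 0 ≤ M := (norm_nonneg _).trans (hM 0)
  set x := x' + (n : ℝ)⁻¹ * s with hx
  by_cases hxr : x ∈ Ioo (-r) r
  · rw [norm_mul]
    have hxs : (n : ℝ) * (x - x') = s := by
      rw [hx]; field_simp; ring
    have := norm_cexp_neg_sq_le ((hest x hxr x' hx').trans (by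
      have := abs_nonneg (x - x'); linarith)) n
    rw [hxs] at this
    exact mul_le_mul this (hM x) (norm_nonneg _) (Real.exp_nonneg _)
  · rw [hs x hxr, zero_smul, mul_zero, norm_zero]
    positivity

lemma exists_bound_smul (hγ' : Continuous γ') (hψ : Continuous ψ) (hc : HasCompactSupport ψ) :
    ∃ M, ∀ x, ‖ψ x • γ' x‖ ≤ M :=
  (hψ.smul hγ').bounded_above_of_compact_support hc.smul_right

lemma norm_gaussian_mean_le
    (hest : ∀ x ∈ Ioo (-r) r, ∀ x' ∈ Ioo (-r) r, ‖γ x - γ x' - ((x - x' : ℝ) : ℂ)‖ ≤ 1 / 4 * |x - x'|)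
    (hs : ∀ x ∉ Ioo (-r) r, ψ x = 0) (hx' : x' ∈ Ioo (-r) r) {M : ℝ}
    (hM : ∀ x, ‖ψ x • γ' x‖ ≤ M) (n : ℕ) :
    ‖(n : ℂ) * ∫ x, cexp (-((n : ℂ) * (γ x - γ x')) ^ 2) * (ψ x • γ' x)‖ ≤
      ∫ s : ℝ, Real.exp (-(1 / 4) * s ^ 2) * M := by
  have hM0 : 0 ≤ M := (norm_nonneg _).trans (hM 0)
  rcases eq_or_ne n 0 with rfl | hn
  · simp only [Nat.cast_zero, zero_mul, norm_zero]
    exact integral_nonneg fun s => by positivity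
  rw [nat_mul_integral_eq_rescale _ x' hn]
  refine norm_integral_le_of_norm_le ((integrable_exp_neg_mul_sq (by norm_num)).mul_const M) ?_
  exact .of_forall fun s => norm_rescaled_gaussian_le hest hs hx' hM hn s

/-- Gaussian means along a curve close to the real axis form an approximate identity. -/
lemma tendsto_gaussian_mean (hγ : ∀ x, HasDerivAt γ (γ' x) x) (hγ' : Continuous γ')
    (hest : ∀ x ∈ Ioo (-r) r, ∀ x' ∈ Ioo (-r) r, ‖γ x - γ x' - ((x - x' : ℝ) : ℂ)‖ ≤ 1 / 4 * |x - x'|)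
    (hest' : ∀ x ∈ Ioo (-r) r, ‖γ' x - 1‖ ≤ 1 / 4)
    (hψ : Continuous ψ) (hc : HasCompactSupport ψ)
    (hs : ∀ x ∉ Ioo (-r) r, ψ x = 0) (hx' : x' ∈ Ioo (-r) r) :
    Tendsto (fun n : ℕ => (n : ℂ) * ∫ x, cexp (-((n : ℂ) * (γ x - γ x')) ^ 2) * (ψ x • γ' x))
      atTop (𝓝 ((√Real.pi : ℝ) * (ψ x' : ℂ))) := by
  obtain ⟨M, hM⟩ := exists_bound_smul hγ' hψ hc
  have hγc : Continuous γ := continuous_iff_continuousAt.2 fun x => (hγ x).continuousAt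
  have hlim : ∫ s : ℝ, cexp (-((s : ℂ) * γ' x') ^ 2) * (ψ x' • γ' x') =
      (√Real.pi : ℝ) * (ψ x' : ℂ) := by
    have h1 := hest' x' hx'
    have hre : |(γ' x').re - 1| ≤ 1 / 4 := by
      simpa using (Complex.abs_re_le_norm (γ' x' - 1)).trans h1
    have him : |(γ' x').im| ≤ 1 / 4 := by
      simpa using (Complex.abs_im_le_norm (γ' x' - 1)).trans h1
    rw [abs_le] at hre him
    have hne : γ' x' ≠ 0 := fun h => by
      rw [h] at hre; norm_num at hre
    have hsq : 0 < (γ' x' ^ 2).re := by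
      simp [pow_two]
      nlinarith
    have hg := integral_gaussian_complex hsq
    have hval : ((Real.pi : ℂ) / γ' x' ^ 2) ^ (1 / 2 : ℂ) = (√Real.pi : ℝ) / γ' x' := by
      have hpos : 0 < (((√Real.pi : ℝ) : ℂ) / γ' x').re := by
        rw [Complex.div_re]
        simp
        have : 0 < Complex.normSq (γ' x') := Complex.normSq_pos.2 hne
        have hre' : 0 < (γ' x').re := by linarith
        have := Real.pi_pos
        positivity
      have h2 := Complex.sq_cpow_two_inv hpos
      rw [div_pow, ← Complex.ofReal_pow, Real.sq_sqrt Real.pi_pos.le] at h2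
      rw [one_div, h2]
    rw [integral_mul_const]
    have : (fun s : ℝ => cexp (-((s : ℂ) * γ' x') ^ 2)) =
        fun s : ℝ => cexp (-(γ' x' ^ 2) * (s : ℂ) ^ 2) := by
      ext s; congr 1; ring
    rw [this, hg, hval, Complex.real_smul]
    field_simp
  rw [← hlim]
  have hev : ∀ᶠ n : ℕ in atTop, n ≠ 0 := eventually_ne_atTop 0
  refine Tendsto.congr' (f₁ := fun n : ℕ => ∫ s : ℝ,
    cexp (-((n : ℂ) * (γ (x' + (n : ℝ)⁻¹ * s) - γ x')) ^ 2) *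
      (ψ (x' + (n : ℝ)⁻¹ * s) • γ' (x' + (n : ℝ)⁻¹ * s))) ?_ ?_
  · filter_upwards [hev] with n hn
    rw [nat_mul_integral_eq_rescale _ x' hn]
  · refine tendsto_integral_filter_of_dominated_convergence
      (fun s => Real.exp (-(1 / 4) * s ^ 2) * M) ?_ ?_
      ((integrable_exp_neg_mul_sq (by norm_num)).mul_const M) ?_
    · refine .of_forall fun n => Continuous.aestronglyMeasurable ?_
      fun_prop
    · filter_upwards [hev] with n hn
      exact .of_forall fun s => norm_rescaled_gaussian_le hest hs hx' hM hn s
    · refine .of_forall fun s => ?_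
      have hx : Tendsto (fun n : ℕ => x' + (n : ℝ)⁻¹ * s) atTop (𝓝 x') := by
        have := (tendsto_inv_atTop_nhds_zero_nat (𝕜 := ℝ)).mul_const s
        simpa using this.const_add x'
      have hd := (hγ x').hasFDerivAt.lim_real s
      have hd' := hd.comp (tendsto_natCast_atTop_atTop (R := ℝ))
      have hd'' : Tendsto (fun n : ℕ => (n : ℂ) * (γ (x' + (n : ℝ)⁻¹ * s) - γ x')) atTop
          (𝓝 ((s : ℂ) * γ' x')) := by
        simpa [Function.comp_def] using hd'
      exact ((hd''.pow 2).neg.cexp).mul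
        (((hψ.tendsto x').comp hx).smul ((hγ'.tendsto x').comp hx))

/-- An integrable function whose Gaussian means along the curve decay exponentially vanishes. -/
lemma ae_eq_zero_of_gaussian_decay (hγ : ∀ x, HasDerivAt γ (γ' x) x) (hγ' : Continuous γ')
    (hest : ∀ x ∈ Ioo (-r) r, ∀ x' ∈ Ioo (-r) r, ‖γ x - γ x' - ((x - x' : ℝ) : ℂ)‖ ≤ 1 / 4 * |x - x'|)
    (hest' : ∀ x ∈ Ioo (-r) r, ‖γ' x - 1‖ ≤ 1 / 4) {w : ℝ → ℂ} (hw : Integrable w)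
    (hw0 : ∀ x ∉ Ioo (-r) r, w x = 0) {ρ : ℝ} (hρ : ρ ≤ r) {B c : ℝ} (hc0 : 0 < c)
    (hdecay : ∀ x ∈ Ioo (-ρ) ρ, ∀ n : ℕ,
      ‖∫ x', cexp (-((n : ℂ) * (γ x - γ x')) ^ 2) * w x'‖ ≤ B * Real.exp (-c * (n : ℝ) ^ 2)) :
    ∀ᵐ x, x ∈ Ioo (-ρ) ρ → w x = 0 := by
  refine isOpen_Ioo.ae_eq_zero_of_integral_contDiff_smul_eq_zero
    (hw.locallyIntegrable.locallyIntegrableOn _) fun ψ hψ hc hsupp => ?_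
  have hγc : Continuous γ := continuous_iff_continuousAt.2 fun x => (hγ x).continuousAt
  have hsρ : ∀ x ∉ Ioo (-ρ) ρ, ψ x = 0 := fun x hx => by
    by_contra h
    exact hx (hsupp (subset_tsupport _ h))
  have hs : ∀ x ∉ Ioo (-r) r, ψ x = 0 := fun x hx =>
    hsρ x fun h => hx ⟨by linarith [h.1], by linarith [h.2]⟩
  obtain ⟨M, hM⟩ := exists_bound_smul hγ' hψ.continuous hc
  have hψi : Integrable fun x => ψ x • γ' x :=
    (hψ.continuous.smul hγ').integrable_of_hasCompactSupport hc.smul_right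
  set J : ℕ → ℝ → ℂ := fun n x' =>
    (n : ℂ) * ∫ x, cexp (-((n : ℂ) * (γ x - γ x')) ^ 2) * (ψ x • γ' x) with hJ
  have hfub : ∀ n : ℕ, ∫ x', J n x' * w x' =
      (n : ℂ) * ∫ x, (ψ x • γ' x) * ∫ x', cexp (-((n : ℂ) * (γ x - γ x')) ^ 2) * w x' := by
    intro n
    have hint : Integrable (Function.uncurry fun x' x : ℝ =>
        cexp (-((n : ℂ) * (γ x - γ x')) ^ 2) * (w x' * (ψ x • γ' x))) (volume.prod volume) := by
      refine (hw.mul_prod hψi).mono ?_ (.of_forall fun p => ?_)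
      · refine AEStronglyMeasurable.mul (Continuous.aestronglyMeasurable ?_)
          (hw.mul_prod hψi).aestronglyMeasurable
        fun_prop
      · simp only [Function.uncurry]
        by_cases h1 : p.1 ∈ Ioo (-r) r
        · by_cases h2 : p.2 ∈ Ioo (-r) r
          · rw [norm_mul]
            refine mul_le_of_le_one_left (norm_nonneg _) ?_
            refine (norm_cexp_neg_sq_le ((hest _ h2 _ h1).trans (by
              have := abs_nonneg (p.2 - p.1); linarith)) n).trans ?_
            rw [Real.exp_le_one_iff]
            nlinarith [sq_nonneg ((n : ℝ) * (p.2 - p.1))]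
          · simp [hs _ h2]
        · simp [hw0 _ h1]
    have := integral_integral_swap hint
    calc _ = (n : ℂ) * ∫ x', ∫ x,
          cexp (-((n : ℂ) * (γ x - γ x')) ^ 2) * (w x' * (ψ x • γ' x)) := by
          rw [← integral_const_mul]
          refine integral_congr_ae (.of_forall fun x' => ?_)
          simp only [hJ]
          rw [mul_assoc, ← integral_mul_const]
          congr 2
          ext x
          ring
      _ = _ := by
          rw [this]
          congr 2
          ext x
          rw [← integral_const_mul]
          congr 1
          ext x'
          ring
  have h1 : Tendsto (fun n => ∫ x', J n x' * w x') atTop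
      (𝓝 (∫ x', ((√Real.pi : ℝ) * (ψ x' : ℂ)) * w x')) := by
    refine tendsto_integral_of_dominated_convergence
      (fun x' => (∫ s : ℝ, Real.exp (-(1 / 4) * s ^ 2) * M) * ‖w x'‖) ?_ (hw.norm.const_mul _) ?_ ?_
    · intro n
      refine AEStronglyMeasurable.mul ?_ hw.aestronglyMeasurable
      have : StronglyMeasurable (Function.uncurry fun x' x : ℝ =>
          cexp (-((n : ℂ) * (γ x - γ x')) ^ 2) * (ψ x • γ' x)) := by
        refine Continuous.stronglyMeasurable ?_
        have := hψ.continuous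
        fun_prop
      exact (this.integral_prod_right.const_mul _).aestronglyMeasurable
    · intro n
      refine .of_forall fun x' => ?_
      by_cases h : x' ∈ Ioo (-r) r
      · rw [norm_mul]
        exact mul_le_mul_of_nonneg_right (norm_gaussian_mean_le hest hs h hM n) (norm_nonneg _)
      · simp [hw0 _ h]
    · refine .of_forall fun x' => ?_
      by_cases h : x' ∈ Ioo (-r) r
      · exact (tendsto_gaussian_mean hγ hγ' hest hest' hψ.continuous hc hs h).mul_const _
      · simp [hw0 _ h]
  have h2 : Tendsto (fun n => ∫ x', J n x' * w x') atTop (𝓝 0) := by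
    set A := ∫ x, ‖ψ x • γ' x‖ with hA
    have hz : Tendsto (fun n : ℕ => (n : ℝ) * (A * (B * Real.exp (-c * (n : ℝ) ^ 2)))) atTop (𝓝 0) := by
      have h3 := ((tendsto_rpow_abs_mul_exp_neg_mul_sq_cocompact hc0 1).mono_left
        atTop_le_cocompact).comp (tendsto_natCast_atTop_atTop (R := ℝ))
      simpa [Function.comp_def, mul_assoc, mul_left_comm, mul_comm] using h3.const_mul (A * B)
    refine squeeze_zero_norm (fun n => ?_) hz
    rw [hfub, norm_mul, Complex.norm_natCast]
    refine mul_le_mul_of_nonneg_left ?_ (Nat.cast_nonneg _)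
    rw [hA, ← integral_mul_const]
    refine norm_integral_le_of_norm_le (hψi.norm.mul_const _) (.of_forall fun x => ?_)
    rw [norm_mul]
    by_cases h : x ∈ Ioo (-ρ) ρ
    · exact mul_le_mul_of_nonneg_left (hdecay x h n) (norm_nonneg _)
    · simp [hsρ x h]
  have h3 := tendsto_nhds_unique h1 h2
  simp_rw [mul_assoc] at h3
  rw [integral_const_mul, mul_eq_zero] at h3
  rcases h3 with h3 | h3
  · exact absurd h3 (by
      rw [Complex.ofReal_eq_zero]
      exact (Real.sqrt_pos.2 Real.pi_pos).ne')
  · simpa [Complex.real_smul] using h3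

end Gaussian

lemma hasDerivAt_fst {f : ℝ × ℝ → ℂ} {p : ℝ × ℝ} (hf : DifferentiableAt ℝ f p) :
    HasDerivAt (fun t => f (t, p.2)) (pdx f p) p.1 :=
  hf.hasFDerivAt.comp_hasDerivAt p.1 ((hasDerivAt_id p.1).prodMk (hasDerivAt_const p.1 p.2))

lemma hasDerivAt_snd {f : ℝ × ℝ → ℂ} {p : ℝ × ℝ} (hf : DifferentiableAt ℝ f p) :
    HasDerivAt (fun t => f (p.1, t)) (pdy f p) p.2 :=
  hf.hasFDerivAt.comp_hasDerivAt p.2 ((hasDerivAt_const p.2 p.1).prodMk (hasDerivAt_id p.2))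

lemma contDiff_pdx {f : ℝ × ℝ → ℂ} (hf : ContDiff ℝ (⊤ : ℕ∞) f) : ContDiff ℝ (⊤ : ℕ∞) (pdx f) :=
  (hf.fderiv_right (m := (⊤ : ℕ∞)) (by exact_mod_cast le_top)).clm_apply contDiff_const

lemma contDiff_pdy {f : ℝ × ℝ → ℂ} (hf : ContDiff ℝ (⊤ : ℕ∞) f) : ContDiff ℝ (⊤ : ℕ∞) (pdy f) :=
  (hf.fderiv_right (m := (⊤ : ℕ∞)) (by exact_mod_cast le_top)).clm_apply contDiff_const

lemma pdy_pdx_eq_pdx_pdy {f : ℝ × ℝ → ℂ} (hf : ContDiff ℝ (⊤ : ℕ∞) f) (p : ℝ × ℝ) :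
    pdy (pdx f) p = pdx (pdy f) p := by
  have hd : DifferentiableAt ℝ (fderiv ℝ f) p :=
    ((hf.fderiv_right (m := (⊤ : ℕ∞)) (by exact_mod_cast le_top)).differentiable (by simp)) p
  have hs : IsSymmSndFDerivAt ℝ f p := hf.contDiffAt.isSymmSndFDerivAt (by
    simpa using WithTop.coe_le_coe.2 (le_top : (2 : ℕ∞) ≤ ⊤))
  have h : ∀ v w : ℝ × ℝ, fderiv ℝ (fun q => fderiv ℝ f q v) p w = fderiv ℝ (fderiv ℝ f) p w v := by
    intro v w
    have := hd.hasFDerivAt.clm_apply (hasFDerivAt_const v p)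
    rw [this.fderiv]
    simp
  change fderiv ℝ (fun q => fderiv ℝ f q (1, 0)) p (0, 1) =
    fderiv ℝ (fun q => fderiv ℝ f q (0, 1)) p (1, 0)
  rw [h, h, hs]

lemma contDiff_comp_of_differentiable {E : Type*} [NormedAddCommGroup E] [NormedSpace ℝ E]
    {h : ℂ → ℂ} (hh : Differentiable ℂ h) {Z : E → ℂ}
    (hZ : ContDiff ℝ (⊤ : ℕ∞) Z) : ContDiff ℝ (⊤ : ℕ∞) (fun p => h (Z p)) :=
  ((hh.contDiff (n := (⊤ : ℕ∞))).restrict_scalars ℝ).comp hZ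

/-- The weak equation tested against `χ(x) θ(y) h(Z) Z_x`, where `Z` is a first integral and
`h` is entire. -/
lemma integral_mul_first_integral_eq_zero {a u Z : ℝ × ℝ → ℂ} {Ω : Set (ℝ × ℝ)}
    (hsol : IsDistribSol a u Ω) (hZ : ContDiff ℝ (⊤ : ℕ∞) Z) {S T : Set ℝ} (hST : S ×ˢ T ⊆ Ω)
    (hL : ∀ p ∈ S ×ˢ T, pdy Z p + a p * pdx Z p = 0) {h : ℂ → ℂ} (hh : Differentiable ℂ h)
    {χ θ : ℝ → ℝ} (hχ : ContDiff ℝ (⊤ : ℕ∞) χ) (hχc : HasCompactSupport χ) (hχs : tsupport χ ⊆ S)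
    (hθ : ContDiff ℝ (⊤ : ℕ∞) θ) (hθc : HasCompactSupport θ) (hθs : tsupport θ ⊆ T) :
    ∫ p in Ω, u p * (deriv θ p.2 • (χ p.1 • (h (Z p) * pdx Z p)) -
      θ p.2 • (deriv χ p.1 • (h (Z p) * pdy Z p))) = 0 := by
  have hhZ := contDiff_comp_of_differentiable hh hZ
  have hZx := contDiff_pdx hZ
  have hZy := contDiff_pdy hZ
  have hχ1 : ContDiff ℝ (⊤ : ℕ∞) (fun p : ℝ × ℝ => χ p.1) := hχ.comp contDiff_fst
  have hθ1 : ContDiff ℝ (⊤ : ℕ∞) (fun p : ℝ × ℝ => θ p.2) := hθ.comp contDiff_snd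
  let ψ : ℝ × ℝ → ℂ := fun p => χ p.1 • θ p.2 • (h (Z p) * pdx Z p)
  have hψ : ContDiff ℝ (⊤ : ℕ∞) ψ := hχ1.smul (hθ1.smul (hhZ.mul hZx))
  have hts : tsupport ψ ⊆ tsupport χ ×ˢ tsupport θ := by
    refine closure_minimal (fun p hp => ?_) ((isClosed_tsupport _).prod (isClosed_tsupport _))
    constructor
    · refine subset_tsupport _ fun h0 => hp ?_
      simp [ψ, h0]
    · refine subset_tsupport _ fun h0 => hp ?_
      simp [ψ, h0]
  have hψc : HasCompactSupport ψ :=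
    (hχc.isCompact.prod hθc.isCompact).of_isClosed_subset (isClosed_tsupport _) hts
  have haψ : (fun q => a q * ψ q) = fun q => -(χ q.1 • θ q.2 • (h (Z q) * pdy Z q)) := by
    ext q
    by_cases hq : q ∈ S ×ˢ T
    · have := hL q hq
      simp only [ψ, Complex.real_smul]
      linear_combination ((χ q.1 : ℂ) * θ q.2 * h (Z q)) * this
    · have : χ q.1 = 0 ∨ θ q.2 = 0 := by
        by_contra! h0
        exact hq ⟨hχs (subset_tsupport _ h0.1), hθs (subset_tsupport _ h0.2)⟩
      rcases this with h0 | h0 <;> simp [ψ, h0]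
  have hmain := hsol ψ hψ hψc (hts.trans ((prod_mono hχs hθs).trans hST))
  rw [haψ] at hmain
  rw [← hmain]
  congr 1
  ext p
  congr 1
  have hne : ((⊤ : ℕ∞) : WithTop ℕ∞) ≠ 0 := by simp
  have hd : ∀ {f : ℝ × ℝ → ℂ}, ContDiff ℝ (⊤ : ℕ∞) f → DifferentiableAt ℝ f p :=
    fun hf => hf.differentiable hne p
  have hχd : HasDerivAt χ (deriv χ p.1) p.1 := (hχ.differentiable hne p.1).hasDerivAt
  have hθd : HasDerivAt θ (deriv θ p.2) p.2 := (hθ.differentiable hne p.2).hasDerivAt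
  have hhd : HasDerivAt h (deriv h (Z p)) (Z p) := (hh (Z p)).hasDerivAt
  have hy : pdy ψ p = χ p.1 • (θ p.2 • (deriv h (Z p) * pdy Z p * pdx Z p +
      h (Z p) * pdy (pdx Z) p) + deriv θ p.2 • (h (Z p) * pdx Z p)) := by
    have h1 : HasDerivAt (fun t => h (Z (p.1, t))) (deriv h (Z p) * pdy Z p) p.2 :=
      HasDerivAt.comp (h₂ := h) p.2 hhd (hasDerivAt_snd (hd hZ))
    exact (hasDerivAt_snd (hd hψ)).unique
      ((hθd.smul (h1.mul (hasDerivAt_snd (hd hZx)))).const_smul (χ p.1))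
  have hx : pdx (fun q => -(χ q.1 • θ q.2 • (h (Z q) * pdy Z q))) p =
      -(χ p.1 • θ p.2 • (deriv h (Z p) * pdx Z p * pdy Z p + h (Z p) * pdx (pdy Z) p) +
        deriv χ p.1 • θ p.2 • (h (Z p) * pdy Z p)) := by
    have h1 : HasDerivAt (fun t => h (Z (t, p.2))) (deriv h (Z p) * pdx Z p) p.1 :=
      HasDerivAt.comp (h₂ := h) p.1 hhd (hasDerivAt_fst (hd hZ))
    exact (hasDerivAt_fst (hd (hχ1.smul (hθ1.smul (hhZ.mul hZy))).neg)).unique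
      (hχd.smul ((h1.mul (hasDerivAt_fst (hd hZy))).const_smul (θ p.2))).neg
  rw [hy, hx, pdy_pdx_eq_pdx_pdy hZ]
  simp only [Complex.real_smul]
  ring

/-- A locally integrable structure has a globally defined smooth function `Z` which, on a small box,
is a first integral and is close to `(x, y) ↦ x` in the `x` direction. -/
lemma exists_normalized_first_integral {a : ℝ × ℝ → ℂ} (hloc : LocallyIntegrableAtOrigin a)
    {a₀ b₀ : ℝ} (ha₀ : 0 < a₀) (hb₀ : 0 < b₀) :
    ∃ Z : ℝ × ℝ → ℂ, ContDiff ℝ (⊤ : ℕ∞) Z ∧ ∃ r b : ℝ, 0 < r ∧ r < a₀ ∧ 0 < b ∧ b ≤ b₀ ∧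
      (∀ p ∈ Ioo (-r) r ×ˢ Ioo (-b) b, pdy Z p + a p * pdx Z p = 0) ∧
      (∀ p ∈ Ioo (-r) r ×ˢ Ioo (-b) b, ‖pdx Z p - 1‖ ≤ 1 / 4) ∧
      (∀ x ∈ Ioo (-r) r, ∀ x' ∈ Ioo (-r) r, ∀ y ∈ Ioo (-b) b,
        ‖Z (x, y) - Z (x', y) - ((x - x' : ℝ) : ℂ)‖ ≤ 1 / 4 * |x - x'|) ∧
      (∀ x ∈ Ioo (-r) r, ∀ x' ∈ Ioo (-r) r, ∀ y ∈ Ioo (-b) b, ∀ y' ∈ Ioo (-b) b,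
        r / 4 ≤ |x - x'| →
        ‖Z (x, y) - Z (x', y') - ((x - x' : ℝ) : ℂ)‖ ≤ 3 / 8 * |x - x'|) := by
  obtain ⟨U, hU, h0U, Z₀, hZ₀, hLZ, hdZ⟩ := hloc
  have happ : ∀ (A : ℝ × ℝ →L[ℝ] ℂ) (s t : ℝ), A (s, t) = s * A (1, 0) + t * A (0, 1) := by
    intro A s t
    have : (s, t) = s • ((1 : ℝ), (0 : ℝ)) + t • ((0 : ℝ), (1 : ℝ)) := by simp
    rw [this, map_add, map_smul, map_smul, Complex.real_smul, Complex.real_smul]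
  have hc : pdx Z₀ (0, 0) ≠ 0 := by
    intro h
    have h2 := hLZ (0, 0) h0U
    rw [h, mul_zero, add_zero] at h2
    refine hdZ (ContinuousLinearMap.ext fun ⟨s, t⟩ => ?_)
    rw [happ]
    change (s : ℂ) * pdx Z₀ (0, 0) + t * pdy Z₀ (0, 0) = 0
    rw [h, h2]; simp
  set c := pdx Z₀ (0, 0) with hcdef
  obtain ⟨ε₁, hε₁, hε₁U⟩ := Metric.isOpen_iff.1 hU _ h0U
  let B : ContDiffBump ((0, 0) : ℝ × ℝ) :=
    ⟨ε₁ / 4, ε₁ / 2, by positivity, by linarith⟩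
  let Z : ℝ × ℝ → ℂ := fun p => B p • (c⁻¹ * Z₀ p)
  have hZ : ContDiff ℝ (⊤ : ℕ∞) Z := by
    rw [contDiff_iff_contDiffAt]
    intro p
    by_cases hp : p ∈ U
    · exact B.contDiff.contDiffAt.smul (contDiffAt_const.mul (hZ₀.contDiffAt (hU.mem_nhds hp)))
    · have hp' : p ∉ tsupport B := by
        rw [B.tsupport_eq]
        exact fun h => hp (hε₁U (Metric.closedBall_subset_ball (half_lt_self hε₁) h))
      refine (contDiffAt_const (c := (0 : ℂ))).congr_of_eventuallyEq ?_
      filter_upwards [notMem_tsupport_iff_eventuallyEq.1 hp'] with q hq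
      simp [Z, hq]
  have hev : ∀ᶠ p in 𝓝 ((0, 0) : ℝ × ℝ), pdy Z p + a p * pdx Z p = 0 := by
    filter_upwards [hU.mem_nhds h0U, eventually_eventually_nhds.2 B.eventuallyEq_one] with p hp hB
    have : Z =ᶠ[𝓝 p] fun q => c⁻¹ * Z₀ q := by
      filter_upwards [hB] with q hq
      simp [Z, hq]
    have hd : DifferentiableAt ℝ Z₀ p := (hZ₀.contDiffAt (hU.mem_nhds hp)).differentiableAt (by simp)
    have h2 := hLZ p hp
    simp only [pdx, pdy] at h2 ⊢
    rw [this.fderiv_eq, fderiv_const_mul hd]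
    simp only [smul_apply, smul_eq_mul]
    linear_combination c⁻¹ * h2
  have hx0 : pdx Z (0, 0) = 1 := by
    have : Z =ᶠ[𝓝 (0, 0)] fun q => c⁻¹ * Z₀ q := by
      filter_upwards [B.eventuallyEq_one] with q hq
      simp [Z, hq]
    have hd : DifferentiableAt ℝ Z₀ (0, 0) :=
      (hZ₀.contDiffAt (hU.mem_nhds h0U)).differentiableAt (by simp)
    simp only [pdx]
    rw [this.fderiv_eq, fderiv_const_mul hd]
    simp only [smul_apply, smul_eq_mul]
    exact inv_mul_cancel₀ hc
  have hev1 : ∀ᶠ p in 𝓝 ((0, 0) : ℝ × ℝ), ‖pdx Z p - 1‖ ≤ 1 / 4 := by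
    have := (contDiff_pdx hZ).continuous.tendsto (0, 0)
    rw [hx0] at this
    filter_upwards [Metric.tendsto_nhds.1 this (1 / 4) (by norm_num)] with p hp
    rw [← dist_eq_norm]; exact hp.le
  have hstrict := ((hZ.contDiffAt (x := (0, 0))).hasStrictFDerivAt (by simp)).isLittleO.def
    (show (0 : ℝ) < 1 / 4 by norm_num)
  rw [nhds_prod_eq] at hstrict
  obtain ⟨V, hV, hVs⟩ := Filter.eventually_prod_self_iff'.1 hstrict
  obtain ⟨ε, hε, hεV⟩ := Metric.mem_nhds_iff.1 (inter_mem hV (inter_mem hev hev1))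
  set α := fderiv ℝ Z (0, 0) (0, 1) with hα
  have hA : ∀ s t : ℝ, fderiv ℝ Z (0, 0) (s, t) = s + t * α := by
    intro s t
    rw [happ]
    change (s : ℂ) * pdx Z (0, 0) + _ = _
    rw [hx0, mul_one]
  set r := min ε a₀ / 2 with hr
  have hr0 : 0 < r := by have := lt_min hε ha₀; positivity
  have hrε : r < ε := by have := min_le_left ε a₀; linarith
  have hra : r < a₀ := by have := min_le_right ε a₀; linarith
  set b := min (min ε b₀) (r / (64 * (‖α‖ + 1))) with hb
  have hb0 : 0 < b := lt_min (lt_min hε hb₀) (by positivity)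
  have hbε : b ≤ ε := (min_le_left _ _).trans (min_le_left _ _)
  have hbb : b ≤ b₀ := (min_le_left _ _).trans (min_le_right _ _)
  have hbα : b * (‖α‖ + 1) ≤ r / 64 := by
    have : b ≤ r / (64 * (‖α‖ + 1)) := min_le_right _ _
    rw [le_div_iff₀ (by positivity)] at this
    linarith
  have hball : ∀ p ∈ Ioo (-r) r ×ˢ Ioo (-b) b, p ∈ Metric.ball ((0, 0) : ℝ × ℝ) ε := by
    rintro ⟨x, y⟩ ⟨hx, hy⟩
    rw [Metric.mem_ball, Prod.dist_eq, Real.dist_eq, Real.dist_eq, sub_zero, sub_zero]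
    exact max_lt ((abs_lt.2 ⟨hx.1, hx.2⟩).trans hrε) ((abs_lt.2 ⟨hy.1, hy.2⟩).trans_le hbε)
  have hest : ∀ p ∈ Ioo (-r) r ×ˢ Ioo (-b) b, ∀ q ∈ Ioo (-r) r ×ˢ Ioo (-b) b,
      ‖Z p - Z q - (((p.1 - q.1 : ℝ) : ℂ) + ((p.2 - q.2 : ℝ) : ℂ) * α)‖ ≤
        1 / 4 * max |p.1 - q.1| |p.2 - q.2| := by
    intro p hp q hq
    have := hVs p (hεV (hball p hp)).1 q (hεV (hball q hq)).1
    rw [← hA]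
    exact this
  refine ⟨Z, hZ, r, b, hr0, hra, hb0, hbb, fun p hp => (hεV (hball p hp)).2.1,
    fun p hp => (hεV (hball p hp)).2.2, ?_, ?_⟩
  · intro x hx x' hx' y hy
    have := hest (x, y) ⟨hx, hy⟩ (x', y) ⟨hx', hy⟩
    simpa using this
  · intro x hx x' hx' y hy y' hy' hxx
    have h1 := hest (x, y) ⟨hx, hy⟩ (x', y') ⟨hx', hy'⟩
    have h2 : |y - y'| ≤ 2 * b := by
      rw [abs_le]
      constructor <;> linarith [hy.1, hy.2, hy'.1, hy'.2]
    have h3 : |y - y'| * ‖α‖ ≤ r / 32 := by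
      have := mul_le_mul_of_nonneg_right h2 (norm_nonneg α)
      nlinarith
    have h4 : |y - y'| ≤ |x - x'| := by
      have := mul_nonneg hb0.le (norm_nonneg α)
      linarith
    simp only [max_eq_left h4] at h1
    calc ‖Z (x, y) - Z (x', y') - ((x - x' : ℝ) : ℂ)‖
        = ‖(Z (x, y) - Z (x', y') - (((x - x' : ℝ) : ℂ) + ((y - y' : ℝ) : ℂ) * α)) +
            ((y - y' : ℝ) : ℂ) * α‖ := by congr 1; ring
      _ ≤ 1 / 4 * |x - x'| + |y - y'| * ‖α‖ := by
          refine (norm_add_le _ _).trans (add_le_add h1 ?_)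
          rw [norm_mul, Complex.norm_real, Real.norm_eq_abs]
      _ ≤ 3 / 8 * |x - x'| := by linarith

section Slices

variable {v : ℝ × ℝ → ℂ} {C a₀ b₀ : ℝ}

lemma isCompact_closed_box : IsCompact (Icc (-a₀) a₀ ×ˢ Icc 0 b₀) := isCompact_Icc.prod isCompact_Icc

lemma integrable_mul_of_bounded_support (hv : Measurable v) (hC : ∀ p, ‖v p‖ ≤ C)
    (h0 : ∀ p ∉ Ioo (-a₀) a₀ ×ˢ Ioo 0 b₀, v p = 0) {K : ℝ × ℝ → ℂ} (hK : Continuous K) :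
    Integrable (fun p => v p * K p) := by
  have hi : IntegrableOn K (Icc (-a₀) a₀ ×ˢ Icc 0 b₀) :=
    hK.continuousOn.integrableOn_compact isCompact_closed_box
  have h1 : IntegrableOn (fun p => v p * K p) (Icc (-a₀) a₀ ×ˢ Icc 0 b₀) :=
    Integrable.bdd_mul hi hv.aestronglyMeasurable (.of_forall hC)
  refine (integrableOn_iff_integrable_of_support_subset fun p hp => ?_).1 h1
  by_contra h
  exact hp (by simp [h0 p fun h' => h ⟨Ioo_subset_Icc_self h'.1, Ioo_subset_Icc_self h'.2⟩])

lemma integrable_slice_mul_of_bounded_support (hv : Measurable v) (hC : ∀ p, ‖v p‖ ≤ C)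
    (h0 : ∀ p ∉ Ioo (-a₀) a₀ ×ˢ Ioo 0 b₀, v p = 0) {K : ℝ → ℂ} (hK : Continuous K) (y : ℝ) :
    Integrable (fun x => v (x, y) * K x) := by
  have hi : IntegrableOn K (Icc (-a₀) a₀) := hK.continuousOn.integrableOn_compact isCompact_Icc
  have h1 : IntegrableOn (fun x => v (x, y) * K x) (Icc (-a₀) a₀) :=
    Integrable.bdd_mul hi (hv.comp measurable_prodMk_right).aestronglyMeasurable
      (.of_forall fun x => hC (x, y))
  refine (integrableOn_iff_integrable_of_support_subset fun x hx => ?_).1 h1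
  by_contra h
  exact hx (by simp [h0 (x, y) fun h' => h (Ioo_subset_Icc_self h'.1)])

/-- A solution of `∫ v (θ'(y) k - θ(y) l) = 0` whose `k`-moment vanishes at `y = 0` satisfies the
integrated equation on almost every slice. -/
lemma ae_slice_integral_eq (hv : Measurable v) (hC : ∀ p, ‖v p‖ ≤ C)
    (h0 : ∀ p ∉ Ioo (-a₀) a₀ ×ˢ Ioo 0 b₀, v p = 0) {k l : ℝ × ℝ → ℂ} (hk : Continuous k)
    (hl : Continuous l) {b : ℝ} (hb : 0 < b) (hbb : b ≤ b₀) {N : Set ℝ} (hN : volume N = 0)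
    (hbv : Tendsto (fun y => ∫ x, v (x, y) * k (x, 0)) (𝓝[Ioo 0 b₀ \ N] 0) (𝓝 0))
    (hweak : ∀ θ : ℝ → ℝ, ContDiff ℝ (⊤ : ℕ∞) θ → HasCompactSupport θ → tsupport θ ⊆ Ioo 0 b →
      ∫ p, v p * (deriv θ p.2 • k p - θ p.2 • l p) = 0) :
    ∀ᵐ y, y ∈ Ioo 0 b →
      ∫ x, v (x, y) * k (x, y) = - ∫ s in (0 : ℝ)..y, ∫ x, v (x, s) * l (x, s) := by
  have hint : ∀ {K : ℝ × ℝ → ℂ}, Continuous K → Integrable (fun p => v p * K p)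
      (volume.prod volume) := fun hK => integrable_mul_of_bounded_support hv hC h0 hK
  have hfub : ∀ {K : ℝ × ℝ → ℂ} (f : ℝ → ℝ), Continuous K → Continuous f →
      ∫ p, v p * (f p.2 • K p) = ∫ y, f y • ∫ x, v (x, y) * K (x, y) := by
    intro K f hK hf
    rw [Measure.volume_eq_prod, integral_prod_symm _ (hint (by fun_prop))]
    congr 1
    ext y
    rw [← integral_smul]
    congr 1
    ext x
    simp only [Complex.real_smul]
    ring
  refine ae_eq_primitive_of_weak_deriv hb (G := fun y => ∫ x, v (x, y) * k (x, y))
    (hint hk).integral_prod_right (hint hl).integral_prod_right hN ?_ ?_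
  · have hC0 : 0 ≤ C := (norm_nonneg _).trans (hC 0)
    have hbv' : Tendsto (fun y => ∫ x, v (x, y) * k (x, 0)) (𝓝[Ioo 0 b \ N] 0) (𝓝 0) :=
      hbv.mono_left (nhdsWithin_mono _ (sdiff_subset_sdiff_left (Ioo_subset_Ioo_right hbb)))
    have hcont : Continuous fun y => ∫ x in Icc (-a₀) a₀, C * ‖k (x, y) - k (x, 0)‖ := by
      refine continuous_parametric_integral_of_continuous (μ := volume) ?_ isCompact_Icc
      fun_prop
    have hlim := (hcont.tendsto 0).mono_left (nhdsWithin_le_nhds (s := Ioo 0 b \ N))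
    simp only [sub_self, norm_zero, mul_zero, integral_zero] at hlim
    have hdiff : Tendsto (fun y => ∫ x, v (x, y) * (k (x, y) - k (x, 0)))
        (𝓝[Ioo 0 b \ N] 0) (𝓝 0) := by
      refine squeeze_zero_norm (fun y => ?_) hlim
      have : ∫ x, v (x, y) * (k (x, y) - k (x, 0)) =
          ∫ x in Icc (-a₀) a₀, v (x, y) * (k (x, y) - k (x, 0)) := by
        refine (setIntegral_eq_integral_of_forall_compl_eq_zero fun x hx => ?_).symm
        rw [h0 (x, y) fun h' => hx (Ioo_subset_Icc_self h'.1), zero_mul]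
      rw [this]
      refine norm_integral_le_of_norm_le
        (Continuous.integrableOn_Icc (by fun_prop)) (.of_forall fun x => ?_)
      rw [norm_mul]
      exact mul_le_mul_of_nonneg_right (hC _) (norm_nonneg _)
    have := hdiff.add hbv'
    rw [add_zero] at this
    refine this.congr fun y => ?_
    rw [← integral_add]
    · congr 1
      ext x
      ring
    · exact integrable_slice_mul_of_bounded_support hv hC h0
        (K := fun x => k (x, y) - k (x, 0)) (by fun_prop) y
    · exact integrable_slice_mul_of_bounded_support hv hC h0 (K := fun x => k (x, 0))
        (by fun_prop) y
  · intro θ h1 h2 h3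
    have hθ' : Continuous (deriv θ) := h1.continuous_deriv (by exact_mod_cast le_top)
    have hθ : Continuous θ := h1.continuous
    have h4 := hweak θ h1 h2 h3
    simp_rw [mul_sub] at h4
    rw [integral_sub (integrable_mul_of_bounded_support hv hC h0 (by fun_prop))
      (integrable_mul_of_bounded_support hv hC h0 (by fun_prop)), hfub _ hk hθ', hfub _ hl hθ,
      sub_eq_zero] at h4
    exact h4

end Slices

/-- Gaussian means are continuous in their centre. -/
lemma continuous_gaussian_integral {X : Type*} [MeasurableSpace X] {μ : Measure X} {f W : X → ℂ}
    (hf : Integrable f μ) (hW : AEStronglyMeasurable W μ) {M : ℝ}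
    (hM : ∀ x, f x ≠ 0 → ‖W x‖ ≤ M) (n : ℕ) :
    Continuous fun z : ℂ => ∫ x, cexp (-((n : ℂ) * (z - W x)) ^ 2) * f x ∂μ := by
  rw [continuous_iff_continuousAt]
  intro z₀
  refine continuousAt_of_dominated
    (bound := fun x => Real.exp ((n * (‖z₀‖ + 1 + M)) ^ 2) * ‖f x‖) ?_ ?_ (hf.norm.const_mul _) ?_
  · refine .of_forall fun z => AEStronglyMeasurable.mul ?_ hf.aestronglyMeasurable
    exact (Continuous.comp_aestronglyMeasurable (g := fun w : ℂ => cexp (-((n : ℂ) * (z - w)) ^ 2))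
      (by fun_prop) hW)
  · filter_upwards [Metric.ball_mem_nhds z₀ one_pos] with z hz
    refine .of_forall fun x => ?_
    by_cases hx : f x = 0
    · simp [hx]
    rw [norm_mul]
    refine mul_le_mul_of_nonneg_right ?_ (norm_nonneg _)
    refine (Complex.norm_exp_le_exp_norm _).trans (Real.exp_le_exp.2 ?_)
    rw [norm_neg, norm_pow, norm_mul, Complex.norm_natCast]
    refine pow_le_pow_left₀ (by positivity) (mul_le_mul_of_nonneg_left ?_ (Nat.cast_nonneg n)) 2
    have h1 : ‖z‖ ≤ ‖z₀‖ + 1 := by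
      rw [Metric.mem_ball, dist_eq_norm] at hz
      have := norm_sub_norm_le z z₀
      linarith
    exact (norm_sub_le _ _).trans (add_le_add h1 (hM x hx))
  · refine .of_forall fun x => Continuous.continuousAt ?_
    fun_prop

/-- If Gaussian moment identities hold for each centre on almost every slice, then on almost every
slice they hold for all centres. -/
lemma ae_forall_gaussian_slice_eq {v : ℝ × ℝ → ℂ} {C a₀ b₀ : ℝ} (hv : Measurable v)
    (hC : ∀ p, ‖v p‖ ≤ C) (h0 : ∀ p ∉ Ioo (-a₀) a₀ ×ˢ Ioo 0 b₀, v p = 0) {Z k l : ℝ × ℝ → ℂ}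
    (hZ : Continuous Z) (hk : Continuous k) (hl : Continuous l) {b : ℝ}
    (heq : ∀ (n : ℕ) (z : ℂ), ∀ᵐ y, y ∈ Ioo 0 b →
      ∫ x, v (x, y) * (cexp (-((n : ℂ) * (z - Z (x, y))) ^ 2) * k (x, y)) =
        - ∫ s in (0 : ℝ)..y, ∫ x,
          v (x, s) * (cexp (-((n : ℂ) * (z - Z (x, s))) ^ 2) * l (x, s))) :
    ∀ᵐ y, y ∈ Ioo 0 b → ∀ (n : ℕ) (z : ℂ),
      ∫ x, v (x, y) * (cexp (-((n : ℂ) * (z - Z (x, y))) ^ 2) * k (x, y)) =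
        - ∫ s in (0 : ℝ)..y, ∫ x,
          v (x, s) * (cexp (-((n : ℂ) * (z - Z (x, s))) ^ 2) * l (x, s)) := by
  obtain ⟨M, hM⟩ := (isCompact_closed_box (a₀ := a₀) (b₀ := b₀)).exists_bound_of_continuousOn
    hZ.continuousOn
  have hMv : ∀ p, v p ≠ 0 → ‖Z p‖ ≤ M := fun p hp => by
    by_cases h : p ∈ Ioo (-a₀) a₀ ×ˢ Ioo 0 b₀
    · exact hM p ⟨Ioo_subset_Icc_self h.1, Ioo_subset_Icc_self h.2⟩
    · exact absurd (h0 p h) hp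
  have hae : ∀ᵐ y, ∀ (n m : ℕ), y ∈ Ioo 0 b →
      ∫ x, v (x, y) * (cexp (-((n : ℂ) * (TopologicalSpace.denseSeq ℂ m - Z (x, y))) ^ 2) *
          k (x, y)) =
        - ∫ s in (0 : ℝ)..y, ∫ x, v (x, s) *
          (cexp (-((n : ℂ) * (TopologicalSpace.denseSeq ℂ m - Z (x, s))) ^ 2) * l (x, s)) :=
    ae_all_iff.2 fun n => ae_all_iff.2 fun m => heq n _
  filter_upwards [hae] with y hy hyb n
  have hleft : Continuous fun z : ℂ =>
      ∫ x, v (x, y) * (cexp (-((n : ℂ) * (z - Z (x, y))) ^ 2) * k (x, y)) := by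
    have := continuous_gaussian_integral (f := fun x => v (x, y) * k (x, y))
      (W := fun x => Z (x, y)) (μ := volume)
      (integrable_slice_mul_of_bounded_support hv hC h0 (K := fun x => k (x, y)) (by fun_prop) y)
      (Continuous.aestronglyMeasurable (by fun_prop))
      (fun x hx => hMv _ (left_ne_zero_of_mul hx)) n
    refine this.congr fun z => ?_
    congr 1
    ext x
    ring
  have hright : Continuous fun z : ℂ => ∫ s in (0 : ℝ)..y, ∫ x,
      v (x, s) * (cexp (-((n : ℂ) * (z - Z (x, s))) ^ 2) * l (x, s)) := by
    have hle : (volume : Measure ℝ).prod (volume.restrict (Ioc 0 y)) ≤ volume.prod volume := by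
      have := Measure.prod_restrict (μ := (volume : Measure ℝ)) (ν := (volume : Measure ℝ))
        univ (Ioc 0 y)
      rw [Measure.restrict_univ] at this
      rw [this]
      exact Measure.restrict_le_self
    have := continuous_gaussian_integral (f := fun p => v p * l p) (W := Z)
      (μ := (volume : Measure ℝ).prod (volume.restrict (Ioc 0 y)))
      ((integrable_mul_of_bounded_support hv hC h0 hl).mono_measure hle)
      hZ.aestronglyMeasurable (fun p hp => hMv _ (left_ne_zero_of_mul hp)) n
    refine this.congr fun z => ?_
    rw [intervalIntegral.integral_of_le hyb.1.le, ← integral_prod_symm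
      (fun p => v p * (cexp (-((n : ℂ) * (z - Z p)) ^ 2) * l p))]
    · congr 1
      ext p
      ring
    · exact (integrable_mul_of_bounded_support hv hC h0 (by fun_prop)).mono_measure hle
  exact fun z => congrFun ((TopologicalSpace.denseRange_denseSeq ℂ).equalizer hleft hright.neg
    (funext fun m => hy n m hyb)) z

/-- Basic one-sided uniqueness: a bounded solution of `Lu = 0` on
`(-a₀,a₀) × (0,b₀)` with vanishing weak boundary value vanishes near the origin. -/
theorem one_sided_uniqueness
    (a₀ b₀ : ℝ) (ha₀ : 0 < a₀) (hb₀ : 0 < b₀)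
    (a : ℝ × ℝ → ℂ) (ha : ContDiffOn ℝ (⊤ : ℕ∞) a (Ioo (-a₀) a₀ ×ˢ Ioo (-b₀) b₀))
    (hloc : LocallyIntegrableAtOrigin a)
    (u : ℝ × ℝ → ℂ) (hu_meas : Measurable u)
    (C : ℝ) (hu_bdd : ∀ p ∈ Ioo (-a₀) a₀ ×ˢ Ioo 0 b₀, ‖u p‖ ≤ C)
    (hsol : IsDistribSol a u (Ioo (-a₀) a₀ ×ˢ Ioo 0 b₀))
    (N : Set ℝ) (hN : N ⊆ Ioo 0 b₀) (hNnull : volume N = 0)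
    (hbu : ∀ φ : ℝ → ℂ, ContDiff ℝ (⊤ : ℕ∞) φ → HasCompactSupport φ → tsupport φ ⊆ Ioo (-a₀) a₀ →
      Tendsto (fun y => ∫ x in Ioo (-a₀) a₀, u (x, y) * φ x)
        (𝓝[Ioo 0 b₀ \ N] 0) (𝓝 0)) :
    ∃ δ : ℝ, 0 < δ ∧
      ∀ᵐ p ∂(volume.restrict (Ioo (-δ) δ ×ˢ Ioo 0 δ)), u p = 0 := by
  obtain ⟨Z, hZ, r, b, hr, hra, hb, hbb, hLZ, hZx, hest, hfar⟩ :=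
    exists_normalized_first_integral hloc ha₀ hb₀
  set Ω := Ioo (-a₀) a₀ ×ˢ Ioo 0 b₀ with hΩdef
  have hΩ : MeasurableSet Ω := measurableSet_Ioo.prod measurableSet_Ioo
  have hC0 : 0 ≤ C :=
    (norm_nonneg _).trans (hu_bdd (0, b₀ / 2) ⟨⟨by linarith, ha₀⟩, ⟨by linarith, by linarith⟩⟩)
  set v : ℝ × ℝ → ℂ := Ω.indicator u with hvdef
  have hv : Measurable v := hu_meas.indicator hΩ
  have hvC : ∀ p, ‖v p‖ ≤ C := fun p => by
    by_cases hp : p ∈ Ω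
    · rw [hvdef, indicator_of_mem hp]; exact hu_bdd p hp
    · rw [hvdef, indicator_of_notMem hp, norm_zero]; exact hC0
  have hv0 : ∀ p ∉ Ω, v p = 0 := fun p hp => indicator_of_notMem hp _
  let B : ContDiffBump (0 : ℝ) := ⟨r / 2, 3 * r / 4, by positivity, by linarith⟩
  have hBin : B.rIn = r / 2 := rfl
  have hBout : B.rOut = 3 * r / 4 := rfl
  set χ : ℝ → ℝ := ⇑B with hχdef
  have hχ : ContDiff ℝ (⊤ : ℕ∞) χ := B.contDiff
  have hχc : HasCompactSupport χ := B.hasCompactSupport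
  have hχs : tsupport χ ⊆ Ioo (-r) r := by
    rw [hχdef, B.tsupport_eq, Real.closedBall_eq_Icc, hBout]
    exact fun x hx => ⟨by linarith [hx.1], by linarith [hx.2]⟩
  have hχ1 : ∀ x ∈ Ioo (-(r / 4)) (r / 4), χ x = 1 := fun x hx =>
    B.one_of_mem_closedBall (by
      rw [Real.closedBall_eq_Icc, hBin]
      exact ⟨by linarith [hx.1], by linarith [hx.2]⟩)
  have hχ0 : ∀ x ∉ Ioo (-r) r, χ x = 0 := fun x hx => by
    by_contra h
    exact hx (hχs (subset_tsupport _ h))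
  have hχ' : ∀ x, deriv χ x ≠ 0 → x ∈ Ioo (-r) r ∧ r / 2 ≤ |x| := fun x hx => by
    refine ⟨hχs (support_deriv_subset hx), ?_⟩
    by_contra! h
    refine hx ?_
    have : χ =ᶠ[𝓝 x] fun _ => 1 :=
      B.eventuallyEq_one_of_mem_ball (by rwa [Metric.mem_ball, Real.dist_eq, sub_zero, hBin])
    rw [this.deriv_eq, deriv_const]
  have hχd : Continuous (deriv χ) := hχ.continuous_deriv (by exact_mod_cast le_top)
  have hpx := contDiff_pdx hZ
  have hpy := contDiff_pdy hZ
  set k : ℝ × ℝ → ℂ := fun p => χ p.1 • pdx Z p with hkdef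
  set l : ℝ × ℝ → ℂ := fun p => deriv χ p.1 • pdy Z p with hldef
  have hk : ContDiff ℝ (⊤ : ℕ∞) k := (hχ.comp contDiff_fst).smul hpx
  have hl : Continuous l := (hχd.comp continuous_fst).smul hpy.continuous
  have hslices := ae_forall_gaussian_slice_eq hv hvC hv0 hZ.continuous hk.continuous hl (b := b)
    fun n z => by
      have hh : Differentiable ℂ fun w : ℂ => cexp (-((n : ℂ) * (z - w)) ^ 2) := by fun_prop
      have hhZ := contDiff_comp_of_differentiable hh hZ
      refine ae_slice_integral_eq hv hvC hv0 (hhZ.mul hk).continuous (hhZ.continuous.mul hl) hb hbb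
        hNnull ?_ ?_
      · have hφ : ContDiff ℝ (⊤ : ℕ∞)
            (fun x : ℝ => cexp (-((n : ℂ) * (z - Z (x, 0))) ^ 2) * k (x, 0)) :=
          (hhZ.mul hk).comp (contDiff_id.prodMk contDiff_const)
        have hts : tsupport (fun x : ℝ => cexp (-((n : ℂ) * (z - Z (x, 0))) ^ 2) * k (x, 0)) ⊆
            tsupport χ := by
          refine closure_mono fun x hx h => hx ?_
          simp [hkdef, h]
        refine (hbu _ hφ (hχc.isCompact.of_isClosed_subset (isClosed_tsupport _) hts)
          (hts.trans (hχs.trans (Ioo_subset_Ioo (by linarith) hra.le)))).congr' ?_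
        filter_upwards [self_mem_nhdsWithin] with y hy
        rw [← integral_indicator measurableSet_Ioo]
        congr 1
        ext x
        by_cases hx : x ∈ Ioo (-a₀) a₀
        · rw [indicator_of_mem hx, hvdef, indicator_of_mem (show (x, y) ∈ Ω from ⟨hx, hy.1⟩)]
        · rw [indicator_of_notMem hx, hv0 (x, y) fun h => hx h.1, zero_mul]
      · intro θ hθ hθc hθs
        have := integral_mul_first_integral_eq_zero hsol hZ (S := Ioo (-r) r) (T := Ioo 0 b)
          (prod_mono (Ioo_subset_Ioo (by linarith) hra.le) (Ioo_subset_Ioo_right hbb))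
          (fun p hp => hLZ p ⟨hp.1, by linarith [hp.2.1], hp.2.2⟩) hh hχ hχc hχs hθ hθc hθs
        rw [← integral_indicator hΩ] at this
        rw [← this]
        congr 1
        ext p
        by_cases hp : p ∈ Ω
        · rw [indicator_of_mem hp, hvdef, indicator_of_mem hp]
          simp only [hkdef, hldef, Complex.real_smul, Pi.mul_apply]
          ring
        · rw [indicator_of_notMem hp, hv0 p hp, zero_mul]
  obtain ⟨M, hM⟩ := (isCompact_closed_box (a₀ := a₀) (b₀ := b₀)).exists_bound_of_continuousOn
    hl.continuousOn
  have hM0 : 0 ≤ M := (norm_nonneg _).trans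
    (hM (0, 0) ⟨⟨by linarith, ha₀.le⟩, ⟨le_rfl, hb₀.le⟩⟩)
  have hdecay : ∀ y ∈ Ioo 0 b, ∀ x ∈ Ioo (-(r / 4)) (r / 4), ∀ n : ℕ,
      ‖∫ s in (0 : ℝ)..y, ∫ x', v (x', s) *
        (cexp (-((n : ℂ) * (Z (x, y) - Z (x', s))) ^ 2) * l (x', s))‖ ≤
      (2 * a₀ * (C * M) * b) * Real.exp (-(r ^ 2 / 64) * (n : ℝ) ^ 2) := by
    intro y hy x hx n
    have hxr : x ∈ Ioo (-r) r := ⟨by linarith [hx.1], by linarith [hx.2]⟩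
    set E := Real.exp (-(r ^ 2 / 64) * (n : ℝ) ^ 2) with hE
    have hpt : ∀ s ∈ Ioc 0 y, ∀ x' ∈ Icc (-a₀) a₀, ‖v (x', s) *
        (cexp (-((n : ℂ) * (Z (x, y) - Z (x', s))) ^ 2) * l (x', s))‖ ≤ C * (E * M) := by
      intro s hs x' hx'
      rw [norm_mul, norm_mul]
      have hsb : s < b := hs.2.trans_lt hy.2
      by_cases hd : deriv χ x' = 0
      · simp only [hldef, hd, zero_smul, norm_zero, mul_zero]
        positivity
      · obtain ⟨h1, h2⟩ := hχ' x' hd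
        have h3 : r / 4 ≤ |x - x'| := by
          have h4 : |x| ≤ r / 4 := (abs_lt.2 ⟨hx.1, hx.2⟩).le
          have h5 := abs_sub_abs_le_abs_sub x' x
          rw [abs_sub_comm] at h5
          linarith
        have h6 := norm_cexp_neg_sq_le (hfar x hxr x' h1 y ⟨by linarith [hy.1], hy.2⟩ s
          ⟨by linarith [hs.1], hsb⟩ h3) n
        have h7 : Real.exp (-(1 / 4) * ((n : ℝ) * (x - x')) ^ 2) ≤ E := by
          rw [hE, Real.exp_le_exp]
          have h8 : (r / 4) ^ 2 ≤ (x - x') ^ 2 := by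
            rw [← sq_abs (x - x')]
            exact pow_le_pow_left₀ (by positivity) h3 2
          have := mul_le_mul_of_nonneg_right h8 (sq_nonneg (n : ℝ))
          nlinarith
        have h9 := hM (x', s) ⟨hx', hs.1.le, (hsb.trans_le hbb).le⟩
        gcongr
        · exact hvC _
        · exact h6.trans h7
    have hin : ∀ s ∈ Ioc 0 y, ‖∫ x', v (x', s) *
        (cexp (-((n : ℂ) * (Z (x, y) - Z (x', s))) ^ 2) * l (x', s))‖ ≤
        C * (E * M) * (2 * a₀) := by
      intro s hs
      rw [← setIntegral_eq_integral_of_forall_compl_eq_zero (s := Icc (-a₀) a₀) fun x' hx' => by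
        rw [hv0 (x', s) fun h => hx' (Ioo_subset_Icc_self h.1), zero_mul]]
      refine (norm_setIntegral_le_of_norm_le_const isCompact_Icc.measure_lt_top
        (hpt s hs)).trans_eq ?_
      rw [Measure.real, Real.volume_Icc, ENNReal.toReal_ofReal (by linarith)]
      ring
    refine (intervalIntegral.norm_integral_le_of_norm_le_const
      (C := C * (E * M) * (2 * a₀)) fun s hs => hin s ?_).trans ?_
    · rwa [uIoc_of_le hy.1.le] at hs
    · rw [sub_zero, abs_of_pos hy.1]
      have hE0 : 0 ≤ E := Real.exp_nonneg _
      calc C * (E * M) * (2 * a₀) * y ≤ C * (E * M) * (2 * a₀) * b :=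
            mul_le_mul_of_nonneg_left hy.2.le (by positivity)
        _ = _ := by ring
  have hzero : ∀ᵐ y, ∀ᵐ x, (x, y) ∈ Ioo (-(r / 4)) (r / 4) ×ˢ Ioo 0 b → v (x, y) = 0 := by
    filter_upwards [hslices] with y hy
    by_cases hyb : y ∈ Ioo 0 b
    swap
    · exact .of_forall fun x hx => absurd hx.2 hyb
    have hyb' : y ∈ Ioo (-b) b := ⟨by linarith [hyb.1], hyb.2⟩
    have hne : ((⊤ : ℕ∞) : WithTop ℕ∞) ≠ 0 := by simp
    have := ae_eq_zero_of_gaussian_decay (γ := fun x => Z (x, y)) (γ' := fun x => pdx Z (x, y))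
      (r := r) (ρ := r / 4) (w := fun x => v (x, y) * k (x, y))
      (fun x => hasDerivAt_fst (p := (x, y)) (hZ.differentiable hne _))
      (by have := hpx.continuous; fun_prop) (fun x hx x' hx' => hest x hx x' hx' y hyb')
      (fun x hx => hZx (x, y) ⟨hx, hyb'⟩)
      (integrable_slice_mul_of_bounded_support hv hvC hv0 (K := fun x => k (x, y))
        (by have := hk.continuous; fun_prop) y)
      (fun x hx => by simp [hkdef, hχ0 x hx]) (by linarith) (c := r ^ 2 / 64) (by positivity)
      (fun x hx n => by
        have h1 := hdecay y hyb x hx n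
        rw [← norm_neg, ← hy hyb n] at h1
        refine (congrArg norm ?_).trans_le h1
        congr 1
        ext x'
        ring)
    filter_upwards [this] with x hx hxy
    have h1 := hx hxy.1
    refine (mul_eq_zero.1 h1).resolve_right fun h2 => ?_
    simp only [hkdef, hχ1 x hxy.1, one_smul] at h2
    have h3 := hZx (x, y) ⟨⟨by linarith [hxy.1.1], by linarith [hxy.1.2]⟩, hyb'⟩
    rw [h2] at h3
    norm_num at h3
  set S := Ioo (-(r / 4)) (r / 4) ×ˢ Ioo 0 b with hS
  have hSm : MeasurableSet S := measurableSet_Ioo.prod measurableSet_Ioo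
  have hmeas : MeasurableSet {p : ℝ × ℝ | p ∈ S → v p = 0} := by
    have : {p : ℝ × ℝ | p ∈ S → v p = 0} = Sᶜ ∪ v ⁻¹' {0} := by
      ext p
      simp [imp_iff_not_or]
    rw [this]
    exact hSm.compl.union (hv (measurableSet_singleton 0))
  have hprod : ∀ᵐ p : ℝ × ℝ, p ∈ S → v p = 0 := by
    rw [Measure.volume_eq_prod, Measure.ae_prod_iff_ae_ae hmeas]
    exact (Measure.ae_ae_comm hmeas).2 hzero
  refine ⟨min (r / 4) b, lt_min (by positivity) hb, ?_⟩
  rw [ae_restrict_iff' (measurableSet_Ioo.prod measurableSet_Ioo)]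
  filter_upwards [hprod] with p hp hpδ
  have h1 := min_le_left (r / 4) b
  have h2 := min_le_right (r / 4) b
  have hpS : p ∈ S := ⟨⟨by linarith [hpδ.1.1], by linarith [hpδ.1.2]⟩,
    ⟨hpδ.2.1, by linarith [hpδ.2.2]⟩⟩
  have hpΩ : p ∈ Ω := ⟨⟨by linarith [hpS.1.1], by linarith [hpS.1.2]⟩,
    ⟨hpS.2.1, by linarith [hpS.2.2]⟩⟩
  rw [← hp hpS, hvdef, indicator_of_mem hpΩ]
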